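/- Let Φ(x) = 2(1 − 1/x)^{x−1} Γ(1/2 + x/2) Γ(x) / (Γ(1 + x/2) Γ(−1/2 + x)) for real x > 1, let F(s) = Φ′(s + 2)/Φ(s + 2) denote the logarithmic derivative, and let κ = 1 + 1/√12. Then for every real s > 0, F(s) > (1/24) [ 1/(κ + s/2)² − 1/(κ + s)² ]. -/

import Mathlib

noncomputable def Phi (x : ℝ) : ℝ :=
  2 * (1 - 1 / x) ^ (x - 1) * (Real.Gamma (1/2 + x/2) * Real.Gamma x) /
    (Real.Gamma (1 + x/2) * Real.Gamma (-1/2 + x))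

noncomputable def kappa : ℝ := 1 + 1 / Real.sqrt 12

open Filter Topology Set

/-- The digamma function on the reals: the logarithmic derivative of `Real.Gamma`. -/
noncomputable def realDigamma : ℝ → ℝ := logDeriv Real.Gamma

lemma differentiableAt_Gamma_of_pos {x : ℝ} (hx : 0 < x) : DifferentiableAt ℝ Real.Gamma x :=
  Real.differentiableAt_Gamma fun m => by
    have : (0 : ℝ) ≤ m := m.cast_nonneg
    linarith

lemma hasDerivAt_log_Gamma {x : ℝ} (hx : 0 < x) :
    HasDerivAt (fun y => Real.log (Real.Gamma y)) (realDigamma x) x :=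
  (differentiableAt_Gamma_of_pos hx).hasDerivAt.log (Real.Gamma_pos_of_pos hx).ne'

lemma realDigamma_add_one {x : ℝ} (hx : 0 < x) :
    realDigamma (x + 1) = realDigamma x + 1 / x := by
  have h₁ : HasDerivAt (fun y => Real.log (Real.Gamma (y + 1))) (realDigamma (x + 1)) x := by
    simpa using (hasDerivAt_log_Gamma (by linarith : 0 < x + 1)).comp_add_const x 1
  have h₂ := (Real.hasDerivAt_log hx.ne').add (hasDerivAt_log_Gamma hx)
  have h₃ : (fun y => Real.log (Real.Gamma (y + 1))) =ᶠ[𝓝 x]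
      fun y => Real.log y + Real.log (Real.Gamma y) := by
    filter_upwards [lt_mem_nhds hx] with y hy
    rw [Real.Gamma_add_one hy.ne', Real.log_mul hy.ne' (Real.Gamma_pos_of_pos hy).ne']
  rw [h₁.unique (h₂.congr_of_eventuallyEq h₃), one_div, add_comm]

lemma realDigamma_monotoneOn : MonotoneOn realDigamma (Ioi 0) := by
  have h := Real.convexOn_log_Gamma.monotoneOn_deriv
    fun x hx => (hasDerivAt_log_Gamma hx).differentiableAt
  exact h.congr fun x hx => (hasDerivAt_log_Gamma hx).deriv

lemma realDigamma_one : realDigamma 1 = -Real.eulerMascheroniConstant := by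
  rw [realDigamma, logDeriv_apply, Real.hasDerivAt_Gamma_one.deriv, Real.Gamma_one, div_one]

lemma realDigamma_one_half :
    realDigamma (1 / 2) = -(Real.eulerMascheroniConstant + 2 * Real.log 2) := by
  have h : √Real.pi ≠ 0 := (Real.sqrt_pos.2 Real.pi_pos).ne'
  rw [realDigamma, logDeriv_apply, Real.hasDerivAt_Gamma_one_half.deriv, Real.Gamma_one_half_eq]
  field_simp

/-- The logarithmic derivative of `Phi` at `s + 2`, in terms of the digamma function. -/
noncomputable def logDerivPhi (s : ℝ) : ℝ :=
  Real.log ((s + 1) / (s + 2)) + 1 / (s + 2) +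
    (realDigamma (s / 2 + 3 / 2) - realDigamma (s / 2 + 2)) / 2 +
    realDigamma (s + 2) - realDigamma (s + 3 / 2)

lemma deriv_Phi_div_Phi {s : ℝ} (hs : 0 ≤ s) :
    deriv Phi (s + 2) / Phi (s + 2) = logDerivPhi s := by
  set x := s + 2 with hx
  set ℓ : ℝ → ℝ := fun y => Real.log 2 + (y - 1) * Real.log (1 - 1 / y) +
    Real.log (Real.Gamma (1 / 2 + y / 2)) + Real.log (Real.Gamma y) -
    Real.log (Real.Gamma (1 + y / 2)) - Real.log (Real.Gamma (-1 / 2 + y)) with hℓ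
  have hexp : ∀ y : ℝ, 1 < y → Phi y = Real.exp (ℓ y) := by
    intro y hy
    have hy₁ : 0 < 1 - 1 / y := by
      rw [sub_pos, div_lt_one (by linarith)]
      exact hy
    simp only [hℓ, Real.exp_sub, Real.exp_add]
    rw [Real.exp_log two_pos, Real.exp_log (Real.Gamma_pos_of_pos (by linarith)),
      Real.exp_log (Real.Gamma_pos_of_pos (by linarith)),
      Real.exp_log (Real.Gamma_pos_of_pos (by linarith)),
      Real.exp_log (Real.Gamma_pos_of_pos (by linarith)), mul_comm (y - 1),
      ← Real.rpow_def_of_pos hy₁, Phi]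
    field_simp
  have hx₀ : x ≠ 0 := by linarith
  have hlog : HasDerivAt (fun y : ℝ => Real.log (1 - 1 / y)) (1 / (x ^ 2 * (1 - 1 / x))) x := by
    have h : HasDerivAt (fun y : ℝ => 1 - 1 / y) (1 / x ^ 2) x := by
      simpa using (hasDerivAt_inv hx₀).const_sub 1
    have h₁ : 1 - 1 / x ≠ 0 := by
      rw [one_sub_div hx₀]
      exact div_ne_zero (by linarith) hx₀
    convert h.log h₁ using 1
    rw [div_div]
  have hhalf : HasDerivAt (fun y : ℝ => y / 2) (1 / 2) x := (hasDerivAt_id x).div_const 2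
  have hder := ((((((((hasDerivAt_id x).sub_const 1).mul hlog).const_add (Real.log 2)).add
    ((hasDerivAt_log_Gamma (x := 1 / 2 + x / 2) (by linarith)).comp x
      (hhalf.const_add (1 / 2)))).add
    (hasDerivAt_log_Gamma (x := x) (by linarith))).sub
    ((hasDerivAt_log_Gamma (x := 1 + x / 2) (by linarith)).comp x (hhalf.const_add 1))).sub
    ((hasDerivAt_log_Gamma (x := -1 / 2 + x) (by linarith)).comp x
      ((hasDerivAt_id x).const_add (-1 / 2))))
  have hder' := hder.exp
  have heq : Phi =ᶠ[𝓝 x] fun y => Real.exp (ℓ y) := by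
    filter_upwards [lt_mem_nhds (by linarith : 1 < x)] with y hy using hexp y hy
  have hPhi := (hder'.congr_of_eventuallyEq heq).deriv
  rw [hPhi, hexp x (by linarith), logDerivPhi]
  refine (mul_div_cancel_left₀ _ (Real.exp_ne_zero _)).trans ?_
  have h₁ : (s + 1) / x = 1 - 1 / x := by
    rw [hx]
    field_simp
    ring
  have h₂ : (x - 1) * (1 / (x ^ 2 * (1 - 1 / x))) = 1 / x := by
    have : x - 1 ≠ 0 := by linarith
    field_simp
  have h₃ : s / 2 + 3 / 2 = 1 / 2 + x / 2 := by rw [hx]; ring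
  have h₄ : s / 2 + 2 = 1 + x / 2 := by rw [hx]; ring
  have h₅ : s + 3 / 2 = -1 / 2 + x := by rw [hx]; ring
  rw [h₁, h₃, h₄, h₅]
  simp only [id]
  rw [h₂]
  ring

lemma logDerivPhi_zero : logDerivPhi 0 = 0 := by
  have h₁ := realDigamma_add_one (x := 1) one_pos
  have h₂ := realDigamma_add_one (x := 1 / 2) (by norm_num)
  rw [realDigamma_one] at h₁
  rw [realDigamma_one_half] at h₂
  norm_num at h₁ h₂
  norm_num [logDerivPhi, h₁, h₂]
  rw [one_div, Real.log_inv]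
  ring

/-- The increment `logDerivPhi s - logDerivPhi (s + 2)` in closed form. -/
lemma logDerivPhi_sub_add_two {s : ℝ} (hs : 0 ≤ s) :
    logDerivPhi s - logDerivPhi (s + 2) =
      Real.log ((s + 1) / (s + 2)) - Real.log ((s + 3) / (s + 4)) +
        (2 / (2 * s + 3) + 2 / (2 * s + 5) - 2 / (s + 3)) := by
  have h₁ := realDigamma_add_one (x := s / 2 + 3 / 2) (by linarith)
  have h₂ := realDigamma_add_one (x := s / 2 + 2) (by linarith)
  have h₃ := realDigamma_add_one (x := s + 2) (by linarith)
  have h₄ := realDigamma_add_one (x := s + 2 + 1) (by linarith)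
  have h₅ := realDigamma_add_one (x := s + 3 / 2) (by linarith)
  have h₆ := realDigamma_add_one (x := s + 3 / 2 + 1) (by linarith)
  have e : logDerivPhi (s + 2) = Real.log ((s + 3) / (s + 4)) + 1 / (s + 4) +
      (realDigamma (s / 2 + 3 / 2 + 1) - realDigamma (s / 2 + 2 + 1)) / 2 +
      realDigamma (s + 2 + 1 + 1) - realDigamma (s + 3 / 2 + 1 + 1) := by
    rw [logDerivPhi]
    ring_nf
  rw [e, h₄, h₆, h₁, h₂, h₃, h₅, logDerivPhi]
  field_simp
  ring

lemma tendsto_logDerivPhi_atTop : Tendsto logDerivPhi atTop (𝓝 0) := by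
  have hinv : ∀ a : ℝ, Tendsto (fun s : ℝ => 1 / (s + a)) atTop (𝓝 0) := fun a => by
    simpa only [one_div] using! (tendsto_atTop_add_const_right atTop a tendsto_id).inv_tendsto_atTop
  have hlog : Tendsto (fun s : ℝ => Real.log ((s + 1) / (s + 2))) atTop (𝓝 0) := by
    have h : Tendsto (fun s : ℝ => 1 - 1 / (s + 2)) atTop (𝓝 1) := by
      simpa using (hinv 2).const_sub 1
    have h' := (Real.continuousAt_log one_ne_zero).tendsto.comp h
    rw [Real.log_one] at h'
    refine h'.congr' ?_
    filter_upwards [eventually_ge_atTop 0] with s hs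
    have : (s + 1) / (s + 2) = 1 - 1 / (s + 2) := by
      field_simp
      ring
    simp [this]
  have hmono : ∀ {a b : ℝ}, 0 < a → a ≤ b → b ≤ a + 1 →
      0 ≤ realDigamma b - realDigamma a ∧ realDigamma b - realDigamma a ≤ 1 / a := by
    intro a b ha hab hb
    have h₁ := realDigamma_monotoneOn (mem_Ioi.2 ha) (mem_Ioi.2 (ha.trans_le hab)) hab
    have h₂ := realDigamma_monotoneOn (mem_Ioi.2 (ha.trans_le hab))
      (mem_Ioi.2 (by linarith)) hb
    rw [realDigamma_add_one ha] at h₂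
    constructor <;> linarith
  have h₁ : Tendsto (fun s : ℝ => realDigamma (s / 2 + 2) - realDigamma (s / 2 + 3 / 2))
      atTop (𝓝 0) := by
    refine tendsto_of_tendsto_of_tendsto_of_le_of_le' tendsto_const_nhds
      (by simpa using (hinv 3).const_mul 2) ?_ ?_
    · filter_upwards [eventually_ge_atTop 0] with s hs
      exact (hmono (by linarith) (by linarith) (by linarith)).1
    · filter_upwards [eventually_ge_atTop 0] with s hs
      refine (hmono (by linarith) (by linarith) (by linarith)).2.trans_eq ?_
      field_simp
  have h₂ : Tendsto (fun s : ℝ => realDigamma (s + 2) - realDigamma (s + 3 / 2))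
      atTop (𝓝 0) := by
    refine tendsto_of_tendsto_of_tendsto_of_le_of_le' tendsto_const_nhds (hinv (3 / 2)) ?_ ?_
    · filter_upwards [eventually_ge_atTop 0] with s hs
      exact (hmono (by linarith) (by linarith) (by linarith)).1
    · filter_upwards [eventually_ge_atTop 0] with s hs
      exact (hmono (by linarith) (by linarith) (by linarith)).2
  have h := ((hlog.add (hinv 2)).sub (h₁.div_const 2)).add h₂
  simp only [add_zero, zero_div, sub_zero] at h
  refine h.congr fun s => ?_
  rw [logDerivPhi]
  ring

/-- The right-hand side of the inequality, with an arbitrary parameter in place of `kappa`. -/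
noncomputable def shiftedBound (k s : ℝ) : ℝ :=
  (1 / 24) * (1 / (k + s / 2) ^ 2 - 1 / (k + s) ^ 2)

lemma shiftedBound_anti {k l s : ℝ} (hk : 0 < k) (hkl : k ≤ l) (hs : 0 ≤ s) :
    shiftedBound l s ≤ shiftedBound k s := by
  have key : ∀ u : ℝ, 0 ≤ u → 1 / (k + u) ^ 2 - 1 / (l + u) ^ 2 =
      (l - k) * (1 / ((k + u) * (l + u) ^ 2) + 1 / ((k + u) ^ 2 * (l + u))) := by
    intro u hu
    have h₁ : k + u ≠ 0 := by linarith
    have h₂ : l + u ≠ 0 := by linarith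
    field_simp
    ring
  have hl : 0 < l := hk.trans_le hkl
  have h : 1 / (k + s) ^ 2 - 1 / (l + s) ^ 2 ≤
      1 / (k + s / 2) ^ 2 - 1 / (l + s / 2) ^ 2 := by
    rw [key s hs, key (s / 2) (by linarith)]
    have : s / 2 ≤ s := by linarith
    have : 0 ≤ l - k := by linarith
    gcongr
  rw [shiftedBound, shiftedBound]
  linarith

lemma tendsto_shiftedBound_atTop (k : ℝ) : Tendsto (shiftedBound k) atTop (𝓝 0) := by
  have hinv : ∀ f : ℝ → ℝ, Tendsto f atTop atTop →
      Tendsto (fun s : ℝ => 1 / f s ^ 2) atTop (𝓝 0) := fun f hf => by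
    simpa only [one_div] using! ((tendsto_pow_atTop two_ne_zero).comp hf).inv_tendsto_atTop
  have h₁ := hinv (fun s => k + s / 2)
    (tendsto_atTop_add_const_left _ _ (tendsto_id.atTop_div_const two_pos))
  have h₂ := hinv (fun s => k + s) (tendsto_atTop_add_const_left _ _ tendsto_id)
  have h := (h₁.sub h₂).const_mul (1 / 24)
  rw [sub_zero, mul_zero] at h
  exact h

/-- The closed form of the increment over `[s, s + 2]` of `logDerivPhi - shiftedBound (5 / 4)`. -/
noncomputable def gapIncrement (s : ℝ) : ℝ :=
  Real.log ((s + 1) / (s + 2)) - Real.log ((s + 3) / (s + 4)) +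
    (2 / (2 * s + 3) + 2 / (2 * s + 5) - 2 / (s + 3)) -
    2 / 3 * (1 / (2 * s + 5) ^ 2 - 1 / (4 * s + 5) ^ 2) +
    2 / 3 * (1 / (2 * s + 9) ^ 2 - 1 / (4 * s + 13) ^ 2)

lemma gapIncrement_eq {s : ℝ} (hs : 0 ≤ s) :
    gapIncrement s = (logDerivPhi s - shiftedBound (5 / 4) s) -
      (logDerivPhi (s + 2) - shiftedBound (5 / 4) (s + 2)) := by
  have h₁ : shiftedBound (5 / 4) s = 2 / 3 * (1 / (2 * s + 5) ^ 2 - 1 / (4 * s + 5) ^ 2) := by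
    rw [shiftedBound, show 5 / 4 + s / 2 = (2 * s + 5) / 4 by ring,
      show 5 / 4 + s = (4 * s + 5) / 4 by ring]
    field_simp
    ring
  have h₂ : shiftedBound (5 / 4) (s + 2) =
      2 / 3 * (1 / (2 * s + 9) ^ 2 - 1 / (4 * s + 13) ^ 2) := by
    rw [shiftedBound, show 5 / 4 + (s + 2) / 2 = (2 * s + 9) / 4 by ring,
      show 5 / 4 + (s + 2) = (4 * s + 13) / 4 by ring]
    field_simp
    ring
  have h₃ := logDerivPhi_sub_add_two hs
  rw [gapIncrement, h₁, h₂]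
  linarith

lemma log_increment_lower_bound {s : ℝ} (hs : 0 ≤ s) :
    -2 * (1 / (s ^ 2 + 5 * s + 5) + 1 / (3 * (s ^ 2 + 5 * s + 5) ^ 3) +
      1 / ((s ^ 2 + 5 * s + 5) ^ 3 * ((s + 1) * (s + 2) * (s + 3) * (s + 4)))) ≤
      Real.log ((s + 1) / (s + 2)) - Real.log ((s + 3) / (s + 4)) := by
  set q := s ^ 2 + 5 * s + 5 with hq
  have hq₁ : 1 < q := by nlinarith
  have hq₀ : 0 < q := by linarith
  have h := Real.log_div_le_sum_range_add (x := 1 / q) (by positivity)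
    ((div_lt_one hq₀).2 hq₁) 2
  have h₁ : (1 + 1 / q) / (1 - 1 / q) = ((s + 3) / (s + 4)) / ((s + 1) / (s + 2)) := by
    have : q - 1 ≠ 0 := by linarith
    field_simp
    rw [hq]
    ring
  have h₂ : (1 / q) ^ (2 * 2 + 1) / (1 - (1 / q) ^ 2) =
      1 / (q ^ 3 * ((s + 1) * (s + 2) * (s + 3) * (s + 4))) := by
    have e : (s + 1) * (s + 2) * (s + 3) * (s + 4) = q ^ 2 - 1 := by rw [hq]; ring
    have : q ^ 2 - 1 ≠ 0 := by nlinarith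
    rw [e, one_div_pow, one_div_pow]
    field_simp
  rw [h₁, h₂, Real.log_div (by positivity) (by positivity)] at h
  simp only [Finset.sum_range_succ, Finset.sum_range_zero] at h
  norm_num at h
  have h₃ : (q ^ 3)⁻¹ / 3 = 1 / (3 * q ^ 3) := by field_simp
  rw [h₃] at h
  simp only [one_div, mul_inv] at h ⊢
  linarith

lemma hasDerivAt_gapIncrement {s : ℝ} (hs : 0 ≤ s) :
    HasDerivAt gapIncrement
      (1 / (s + 1) + 1 / (s + 4) - 1 / (s + 2) - 1 / (s + 3) +
        (-4 / (2 * s + 3) ^ 2 - 4 / (2 * s + 5) ^ 2 + 2 / (s + 3) ^ 2) +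
        8 / 3 * (1 / (2 * s + 5) ^ 3 - 2 / (4 * s + 5) ^ 3) -
        8 / 3 * (1 / (2 * s + 9) ^ 3 - 2 / (4 * s + 13) ^ 3)) s := by
  have hlin : ∀ a b : ℝ, HasDerivAt (fun y : ℝ => a * y + b) a s := fun a b => by
    simpa using ((hasDerivAt_id s).const_mul a).add_const b
  have hadd : ∀ b : ℝ, HasDerivAt (fun y : ℝ => y + b) 1 s := fun b =>
    (hasDerivAt_id s).add_const b
  have hinv : ∀ {f : ℝ → ℝ} {f' : ℝ}, HasDerivAt f f' s → 0 < f s →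
      HasDerivAt (fun y => 2 / f y) (-2 * f' / f s ^ 2) s := fun hf h0 => by
    refine ((hasDerivAt_const s (2 : ℝ)).div hf h0.ne').congr_deriv ?_
    ring
  have hsq : ∀ {f : ℝ → ℝ} {f' : ℝ}, HasDerivAt f f' s → 0 < f s →
      HasDerivAt (fun y => 1 / f y ^ 2) (-2 * f' / f s ^ 3) s := fun hf h0 => by
    refine ((hasDerivAt_const s (1 : ℝ)).div (hf.pow 2) (pow_pos h0 2).ne').congr_deriv ?_
    simp only [Pi.pow_apply]
    field_simp
    ring
  have hlog : ∀ a b : ℝ, 0 < s + a → 0 < s + b →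
      HasDerivAt (fun y : ℝ => Real.log ((y + a) / (y + b))) (1 / (s + a) - 1 / (s + b)) s :=
    fun a b ha hb => by
      refine (((hadd a).div (hadd b) hb.ne').log (div_pos ha hb).ne').congr_deriv ?_
      simp only [Pi.div_apply]
      field_simp
  have h := ((((hlog 1 2 (by linarith) (by linarith)).sub
    (hlog 3 4 (by linarith) (by linarith))).add
    (((hinv (hlin 2 3) (by linarith)).add (hinv (hlin 2 5) (by linarith))).sub
      (hinv (hadd 3) (by linarith)))).sub
    (((hsq (hlin 2 5) (by linarith)).sub (hsq (hlin 4 5) (by linarith))).const_mul (2 / 3))).add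
    (((hsq (hlin 2 9) (by linarith)).sub (hsq (hlin 4 13) (by linarith))).const_mul (2 / 3))
  refine h.congr_deriv ?_
  ring

lemma strictMonoOn_exp_mul_gapIncrement :
    StrictMonoOn (fun s => Real.exp s * gapIncrement s) (Ici 0) := by
  have hder : ∀ s : ℝ, 0 ≤ s → HasDerivAt (fun s => Real.exp s * gapIncrement s) _ s :=
    fun s hs => (Real.hasDerivAt_exp s).mul (hasDerivAt_gapIncrement hs)
  refine strictMonoOn_of_deriv_pos (convex_Ici 0)
    (fun s hs => (hder s hs).continuousAt.continuousWithinAt) fun s hs => ?_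
  rw [interior_Ici] at hs
  have hs₀ : 0 ≤ s := (mem_Ioi.1 hs).le
  rw [(hder s hs₀).deriv, ← mul_add]
  refine mul_pos (Real.exp_pos s) ?_
  have hrat : 0 < -2 * (1 / (s ^ 2 + 5 * s + 5) + 1 / (3 * (s ^ 2 + 5 * s + 5) ^ 3) +
      1 / ((s ^ 2 + 5 * s + 5) ^ 3 * ((s + 1) * (s + 2) * (s + 3) * (s + 4)))) +
      (2 / (2 * s + 3) + 2 / (2 * s + 5) - 2 / (s + 3)) -
      2 / 3 * (1 / (2 * s + 5) ^ 2 - 1 / (4 * s + 5) ^ 2) +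
      2 / 3 * (1 / (2 * s + 9) ^ 2 - 1 / (4 * s + 13) ^ 2) +
      (1 / (s + 1) + 1 / (s + 4) - 1 / (s + 2) - 1 / (s + 3) +
        (-4 / (2 * s + 3) ^ 2 - 4 / (2 * s + 5) ^ 2 + 2 / (s + 3) ^ 2) +
        8 / 3 * (1 / (2 * s + 5) ^ 3 - 2 / (4 * s + 5) ^ 3) -
        8 / 3 * (1 / (2 * s + 9) ^ 3 - 2 / (4 * s + 13) ^ 3)) := by
    field_simp
    ring_nf
    positivity
  have hlog := log_increment_lower_bound hs₀
  rw [gapIncrement]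
  linarith

lemma shiftedBound_lt_logDerivPhi {s : ℝ} (hs : 0 < s) :
    shiftedBound (5 / 4) s < logDerivPhi s := by
  set G : ℝ → ℝ := fun s => logDerivPhi s - shiftedBound (5 / 4) s with hG
  have hG₀ : G 0 = 0 := by simp [hG, logDerivPhi_zero, shiftedBound]
  have hstep : ∀ t : ℝ, 0 ≤ t → gapIncrement t < Real.exp s * gapIncrement (s + t) := by
    intro t ht
    have h := strictMonoOn_exp_mul_gapIncrement (mem_Ici.2 ht) (mem_Ici.2 (by linarith))
      (by linarith : t < s + t)
    simp only [add_comm s t, Real.exp_add, mul_assoc] at h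
    rw [add_comm]
    exact lt_of_mul_lt_mul_left h (Real.exp_pos t).le
  have hsum : ∀ N : ℕ, Real.exp s * gapIncrement s - gapIncrement 0 ≤
      Real.exp s * (G s - G (s + 2 * (N + 1 : ℕ))) - (G 0 - G (2 * (N + 1 : ℕ))) := by
    intro N
    induction N with
    | zero =>
      rw [gapIncrement_eq hs.le, gapIncrement_eq le_rfl]
      simp [hG]
    | succ N ih =>
      have h := hstep (2 * (N + 1 : ℕ)) (by positivity)
      rw [gapIncrement_eq (by positivity), gapIncrement_eq (by positivity)] at h
      have e₁ : s + 2 * ((N + 1 + 1 : ℕ) : ℝ) = s + 2 * ((N + 1 : ℕ) : ℝ) + 2 := by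
        push_cast; ring
      have e₂ : 2 * ((N + 1 + 1 : ℕ) : ℝ) = 2 * ((N + 1 : ℕ) : ℝ) + 2 := by push_cast; ring
      rw [e₁, e₂]
      simp only [hG] at ih ⊢
      linarith
  have hlim : Tendsto G atTop (𝓝 0) := by
    simpa using tendsto_logDerivPhi_atTop.sub (tendsto_shiftedBound_atTop (5 / 4))
  have hseq : Tendsto (fun N : ℕ => 2 * ((N + 1 : ℕ) : ℝ)) atTop atTop :=
    (tendsto_natCast_atTop_atTop.comp (tendsto_add_atTop_nat 1)).const_mul_atTop two_pos
  have h₁ := hlim.comp (tendsto_atTop_add_const_left _ s hseq)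
  have h₂ := hlim.comp hseq
  have hle := ge_of_tendsto' (((h₁.const_sub (G s)).const_mul (Real.exp s)).sub
    (h₂.const_sub (G 0))) hsum
  have h₀ := hstep 0 le_rfl
  rw [add_zero] at h₀
  rw [hG₀, sub_zero, sub_zero, sub_zero] at hle
  have : 0 < G s := pos_of_mul_pos_right (by linarith : 0 < Real.exp s * G s) (Real.exp_pos s).le
  exact sub_pos.1 this

lemma five_fourths_le_kappa : 5 / 4 ≤ kappa := by
  have h : √12 ≤ 4 := by
    rw [Real.sqrt_le_left (by norm_num)]
    norm_num
  have := one_div_le_one_div_of_le (by positivity) h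
  rw [kappa]
  linarith

theorem stmt_12 (s : ℝ) (hs : s > 0) :
    deriv Phi (s + 2) / Phi (s + 2) >
      (1/24) * (1 / (kappa + s/2) ^ 2 - 1 / (kappa + s) ^ 2) := by
  calc
    (1 / 24) * (1 / (kappa + s / 2) ^ 2 - 1 / (kappa + s) ^ 2)
        ≤ shiftedBound (5 / 4) s := shiftedBound_anti (by norm_num) five_fourths_le_kappa hs.le
    _ < logDerivPhi s := shiftedBound_lt_logDerivPhi hs
    _ = deriv Phi (s + 2) / Phi (s + 2) := (deriv_Phi_div_Phi hs.le).symm
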